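/- Let I ⊆ S = k[x_1,…,x_n] be a homogeneous ideal, M ∈ Z^{d×n} a weighting matrix, and ≺ a total group order on Z^d. Then there exists a weight vector w ∈ Z^n such that init_w(I) = init_M(I). -/

import Mathlib

/- STATEMENT 10: for a homogeneous ideal `I ⊆ k[x_1,…,x_n]`, a weighting matrix
`M ∈ ℤ^{d×n}` and a total group order `≺` on `ℤ^d`, there is a single weight
vector `w ∈ ℤ^n` with `init_w(I) = init_M(I)`. -/

open MvPolynomial
open scoped Classical

noncomputable section

/-- `w·a ∈ ℤ` for a monomial exponent `a`. -/
def wdotZ {n : ℕ} (w : Fin n → ℤ) (a : Fin n →₀ ℕ) : ℤ := ∑ i, w i * (a i : ℤ)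

/-- The initial form of `f` with respect to the integral weight vector `w`. -/
def initFormZ {k : Type*} [Field k] {n : ℕ} (w : Fin n → ℤ) (f : MvPolynomial (Fin n) k) :
    MvPolynomial (Fin n) k :=
  ∑ b ∈ f.support.filter (fun b => ∀ a ∈ f.support, wdotZ w a ≤ wdotZ w b),
    monomial b (coeff b f)

/-- The initial ideal of `I` with respect to the integral weight vector `w`. -/
def initIdealZ {k : Type*} [Field k] {n : ℕ} (w : Fin n → ℤ)
    (I : Ideal (MvPolynomial (Fin n) k)) : Ideal (MvPolynomial (Fin n) k) :=
  Ideal.span {g | ∃ f ∈ I, f ≠ 0 ∧ g = initFormZ w f}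

/-- `M·a ∈ ℤ^d` for a monomial exponent `a`. -/
def MdotZ {d n : ℕ} (M : Fin d → Fin n → ℤ) (a : Fin n →₀ ℕ) : Fin d → ℤ :=
  fun t => ∑ j, M t j * (a j : ℤ)

/-- The initial form of `f` with respect to the weighting matrix `M` and the total
order `le` on `ℤ^d`. -/
def initFormMZ {k : Type*} [Field k] {d n : ℕ} (le : (Fin d → ℤ) → (Fin d → ℤ) → Prop)
    (M : Fin d → Fin n → ℤ) (f : MvPolynomial (Fin n) k) : MvPolynomial (Fin n) k :=
  ∑ b ∈ f.support.filter (fun b => ∀ a ∈ f.support, le (MdotZ M a) (MdotZ M b)),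
    monomial b (coeff b f)

/-- The initial ideal of `I` with respect to the weighting matrix `M`. -/
def initIdealMZ {k : Type*} [Field k] {d n : ℕ} (le : (Fin d → ℤ) → (Fin d → ℤ) → Prop)
    (M : Fin d → Fin n → ℤ) (I : Ideal (MvPolynomial (Fin n) k)) :
    Ideal (MvPolynomial (Fin n) k) :=
  Ideal.span {g | ∃ f ∈ I, f ≠ 0 ∧ g = initFormMZ le M f}

/-- Given finitely many elements of `ℤ^n` on which an additive map to an ordered group is positive,
some rational linear form is positive on all of them. -/
theorem exists_rat_functional_pos {Γ : Type*} [AddCommGroup Γ] [LinearOrder Γ]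
    [IsOrderedAddMonoid Γ] (n : ℕ) (V : (Fin n → ℤ) →+ Γ) (P : Finset (Fin n → ℤ))
    (hP : ∀ p ∈ P, 0 < V p) : ∃ w : Fin n → ℚ, ∀ p ∈ P, 0 < ∑ i, w i * (p i : ℚ) := by
  induction n with
  | zero =>
    refine ⟨0, fun p hp => ?_⟩
    have h := hP p hp
    rw [Subsingleton.elim p 0, map_zero] at h
    exact absurd h (lt_irrefl _)
  | succ n ih =>
    let e : (Fin n → ℤ) →+ (Fin (n + 1) → ℤ) :=
      { toFun := fun x => Fin.cons 0 x
        map_zero' := by ext i; refine Fin.cases ?_ (fun i => ?_) i <;> simp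
        map_add' := fun x y => by ext i; refine Fin.cases ?_ (fun i => ?_) i <;> simp }
    have he : ∀ p : Fin (n + 1) → ℤ, p 0 = 0 → e (Fin.tail p) = p := fun p hp => by
      ext i
      refine Fin.cases ?_ (fun i => ?_) i <;> simp [e, hp, Fin.tail]
    let P₀ := (P.filter (fun p => p 0 = 0)).image Fin.tail
    let P₁ := ((P.filter (fun p => 0 < p 0)) ×ˢ (P.filter (fun p => p 0 < 0))).image
      (fun x => Fin.tail ((-x.2 0) • x.1 + x.1 0 • x.2))
    obtain ⟨w, hw⟩ := ih (V.comp e) (P₀ ∪ P₁) (by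
      intro p hp
      rw [Finset.mem_union] at hp
      rcases hp with hp | hp
      · simp only [P₀, Finset.mem_image, Finset.mem_filter] at hp
        obtain ⟨a, ⟨ha, ha0⟩, rfl⟩ := hp
        rw [AddMonoidHom.comp_apply, he a ha0]
        exact hP a ha
      · simp only [P₁, Finset.mem_image, Finset.mem_product, Finset.mem_filter] at hp
        obtain ⟨⟨a, b⟩, ⟨⟨ha, ha0⟩, hb, hb0⟩, rfl⟩ := hp
        dsimp only at ha hb ha0 hb0
        rw [AddMonoidHom.comp_apply, he _ (by simp; ring), map_add, map_zsmul, map_zsmul]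
        exact add_pos (zsmul_pos (hP a ha) (neg_pos.2 hb0)) (zsmul_pos (hP b hb) ha0))
    let L : (Fin (n + 1) → ℤ) → ℚ := fun p => ∑ i, w i * (Fin.tail p i : ℚ)
    obtain ⟨t, hlo, hhi⟩ := Order.exists_between_finsets
      ((P.filter (fun p => 0 < p 0)).image (fun p => -L p / (p 0 : ℚ)))
      ((P.filter (fun p => p 0 < 0)).image (fun p => L p / (-(p 0 : ℚ)))) (by
        intro x hx y hy
        simp only [Finset.mem_image, Finset.mem_filter] at hx hy
        obtain ⟨a, ⟨ha, ha0⟩, rfl⟩ := hx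
        obtain ⟨b, ⟨hb, hb0⟩, rfl⟩ := hy
        have h := hw (Fin.tail ((-b 0) • a + a 0 • b)) (Finset.mem_union_right _
          (Finset.mem_image.2 ⟨(a, b), by simp [ha, ha0, hb, hb0], rfl⟩))
        have h2 : ∑ i, w i * (Fin.tail ((-b 0) • a + a 0 • b) i : ℚ)
            = (-(b 0 : ℚ)) * L a + (a 0 : ℚ) * L b := by
          simp only [L, Finset.mul_sum, ← Finset.sum_add_distrib]
          refine Finset.sum_congr rfl fun i _ => ?_
          simp only [Fin.tail, Pi.add_apply, Pi.smul_apply, smul_eq_mul]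
          push_cast
          ring
        rw [h2] at h
        have ha' : (0 : ℚ) < a 0 := by exact_mod_cast ha0
        have hb' : (0 : ℚ) < -(b 0 : ℚ) := by
          have : (b 0 : ℚ) < 0 := by exact_mod_cast hb0
          linarith
        rw [div_lt_div_iff₀ ha' hb']
        linarith)
    refine ⟨Fin.cons t w, fun p hp => ?_⟩
    have hsum : ∑ i, (Fin.cons t w : Fin (n + 1) → ℚ) i * (p i : ℚ) = t * p 0 + L p := by
      rw [Fin.sum_univ_succ]
      simp [L, Fin.tail]
    rw [hsum]
    rcases lt_trichotomy (p 0) 0 with h | h | h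
    · have hh := hhi _ (Finset.mem_image_of_mem _ (Finset.mem_filter.2 ⟨hp, h⟩))
      have h' : (0 : ℚ) < -(p 0 : ℚ) := by
        have : (p 0 : ℚ) < 0 := by exact_mod_cast h
        linarith
      rw [lt_div_iff₀ h'] at hh
      linarith
    · have hh := hw (Fin.tail p) (Finset.mem_union_left _
        (Finset.mem_image_of_mem _ (Finset.mem_filter.2 ⟨hp, h⟩)))
      simpa [h] using hh
    · have hh := hlo _ (Finset.mem_image_of_mem _ (Finset.mem_filter.2 ⟨hp, h⟩))
      have h' : (0 : ℚ) < (p 0 : ℚ) := by exact_mod_cast h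
      rw [div_lt_iff₀ h'] at hh
      linarith

/-- Given finitely many elements of `ℤ^n` on which an additive map to an ordered group is positive,
some integral linear form is positive on all of them. -/
theorem exists_int_functional_pos {Γ : Type*} [AddCommGroup Γ] [LinearOrder Γ]
    [IsOrderedAddMonoid Γ] (n : ℕ) (V : (Fin n → ℤ) →+ Γ) (P : Finset (Fin n → ℤ))
    (hP : ∀ p ∈ P, 0 < V p) : ∃ w : Fin n → ℤ, ∀ p ∈ P, 0 < ∑ i, w i * p i := by
  obtain ⟨w, hw⟩ := exists_rat_functional_pos n V P hP
  let N : ℤ := ∏ i, ((w i).den : ℤ)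
  have hN : 0 < N := Finset.prod_pos fun i _ => by exact_mod_cast (w i).den_pos
  have hint : ∀ i, ∃ z : ℤ, (z : ℚ) = N * w i := fun i => by
    obtain ⟨c, hc⟩ : ((w i).den : ℤ) ∣ N := Finset.dvd_prod_of_mem _ (Finset.mem_univ i)
    refine ⟨c * (w i).num, ?_⟩
    rw [hc]
    push_cast
    rw [mul_right_comm, Rat.den_mul_eq_num, mul_comm]
  choose z hz using hint
  refine ⟨z, fun p hp => ?_⟩
  have h : ((∑ i, z i * p i : ℤ) : ℚ) = N * ∑ i, w i * (p i : ℚ) := by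
    push_cast
    rw [Finset.mul_sum]
    exact Finset.sum_congr rfl fun i _ => by rw [hz]; ring
  have h2 : (0 : ℚ) < N * ∑ i, w i * (p i : ℚ) := mul_pos (by exact_mod_cast hN) (hw p hp)
  rw [← h] at h2
  exact_mod_cast h2

/-- A finitely generated ordered abelian group admits, for each finite set of positive elements,
a homomorphism to `ℤ` which is positive on that set. -/
theorem exists_linearMap_int_pos {Γ : Type*} [AddCommGroup Γ] [LinearOrder Γ]
    [IsOrderedAddMonoid Γ] [Module.Finite ℤ Γ] (P : Finset Γ)
    (hP : ∀ p ∈ P, 0 < p) : ∃ φ : Γ →ₗ[ℤ] ℤ, ∀ p ∈ P, 0 < φ p := by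
  let b := Module.finBasis ℤ Γ
  obtain ⟨w, hw⟩ := exists_int_functional_pos _ b.equivFun.symm.toLinearMap.toAddMonoidHom
    (P.image b.equivFun) (by
      intro p hp
      obtain ⟨x, hx, rfl⟩ := Finset.mem_image.1 hp
      simpa using hP x hx)
  refine ⟨(Fintype.linearCombination ℤ w).comp b.equivFun.toLinearMap, fun p hp => ?_⟩
  have h := hw _ (Finset.mem_image_of_mem _ hp)
  simpa [Fintype.linearCombination_apply, mul_comm] using h

/-- Finitely many comparisons between weights in an ordered group are realized by an integral
weight vector. -/
theorem exists_int_weight_strictMonoOn {Γ : Type*} [AddCommGroup Γ] [LinearOrder Γ]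
    [IsOrderedAddMonoid Γ] {n : ℕ} (v : Fin n → Γ) (D : Finset (Fin n →₀ ℕ)) :
    ∃ w : Fin n → ℤ, ∀ a ∈ D, ∀ b ∈ D,
      (Finsupp.weight v a < Finsupp.weight v b → Finsupp.weight w a < Finsupp.weight w b) ∧
      (Finsupp.weight v a = Finsupp.weight v b → Finsupp.weight w a = Finsupp.weight w b) := by
  let H := Submodule.span ℤ (Set.range v)
  have : Module.Finite ℤ H := Module.Finite.span_of_finite ℤ (Set.finite_range v)
  let u : Fin n → H := fun i => ⟨v i, Submodule.subset_span ⟨i, rfl⟩⟩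
  have hu : ∀ a : Fin n →₀ ℕ, ((Finsupp.weight u a : H) : Γ) = Finsupp.weight v a := fun a => by
    simp [Finsupp.weight_apply, Finsupp.sum, u]
  obtain ⟨φ, hφ⟩ := exists_linearMap_int_pos (((D ×ˢ D).image
    (fun x => Finsupp.weight u x.2 - Finsupp.weight u x.1)).filter (0 < ·))
    (fun p hp => (Finset.mem_filter.1 hp).2)
  have hw : ∀ a : Fin n →₀ ℕ, Finsupp.weight (fun i => φ (u i)) a = φ (Finsupp.weight u a) :=
    fun a => by simp [Finsupp.weight_apply, Finsupp.sum]
  refine ⟨fun i => φ (u i), fun a ha b hb => ⟨fun h => ?_, fun h => ?_⟩⟩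
  · rw [hw, hw, ← sub_pos, ← map_sub]
    refine hφ _ (Finset.mem_filter.2 ⟨Finset.mem_image.2 ⟨(a, b), by simp [ha, hb], rfl⟩, ?_⟩)
    rw [sub_pos, ← Subtype.coe_lt_coe, hu, hu]
    exact h
  · rw [hw, hw, Subtype.ext (((hu a).trans h).trans (hu b).symm)]

/-- The ideal spanned by the top-weight parts of the homogeneous elements of `I`. -/
def topIdeal {k Γ : Type*} [Field k] [AddCommGroup Γ] [LinearOrder Γ] {n : ℕ}
    (v : Fin n → Γ) (I : Ideal (MvPolynomial (Fin n) k)) : Ideal (MvPolynomial (Fin n) k) :=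
  Ideal.span {g | ∃ f ∈ I, ∃ (j : ℕ) (q : Γ), f.IsHomogeneous j ∧
    (∀ a ∈ f.support, Finsupp.weight v a ≤ q) ∧ g = weightedHomogeneousComponent v q f}

theorem homogeneousComponent_weightedHomogeneousComponent {k Γ : Type*} [Field k]
    [AddCommGroup Γ] {n : ℕ} (v : Fin n → Γ) (q : Γ) (j : ℕ) (f : MvPolynomial (Fin n) k) :
    homogeneousComponent j (weightedHomogeneousComponent v q f) =
      weightedHomogeneousComponent v q (homogeneousComponent j f) := by
  ext b
  simp only [coeff_homogeneousComponent, coeff_weightedHomogeneousComponent]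
  split_ifs <;> rfl

/-- For a homogeneous ideal, the ideal of all initial forms is spanned by the initial forms of
homogeneous elements. -/
theorem span_initForm_eq_topIdeal {k Γ : Type*} [Field k] [AddCommGroup Γ] [LinearOrder Γ] {n : ℕ}
    (v : Fin n → Γ) (I : Ideal (MvPolynomial (Fin n) k))
    (hI : ∀ f ∈ I, ∀ j : ℕ, homogeneousComponent j f ∈ I)
    (initForm : MvPolynomial (Fin n) k → MvPolynomial (Fin n) k)
    (h : ∀ f ≠ 0, ∃ b ∈ f.support, (∀ a ∈ f.support, Finsupp.weight v a ≤ Finsupp.weight v b) ∧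
      initForm f = weightedHomogeneousComponent v (Finsupp.weight v b) f) :
    Ideal.span {g | ∃ f ∈ I, f ≠ 0 ∧ g = initForm f} = topIdeal v I := by
  apply le_antisymm
  · rw [Ideal.span_le]
    rintro g ⟨f, hf, hf0, rfl⟩
    obtain ⟨b, -, hmax, hb⟩ := h f hf0
    rw [SetLike.mem_coe, hb, ← sum_homogeneousComponent (weightedHomogeneousComponent v _ f)]
    refine Ideal.sum_mem _ fun j _ => Ideal.subset_span ⟨homogeneousComponent j f, hI f hf j, j,
      Finsupp.weight v b, homogeneousComponent_isHomogeneous _ _, fun a ha => hmax a ?_,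
      homogeneousComponent_weightedHomogeneousComponent _ _ _ _⟩
    rw [mem_support_iff, coeff_homogeneousComponent] at ha
    rw [mem_support_iff]
    intro h0
    simp [h0] at ha
  · rw [topIdeal, Ideal.span_le]
    rintro g ⟨f, hf, j, q, -, hq, rfl⟩
    by_cases hf0 : f = 0
    · simp [hf0]
    obtain ⟨b, hbs, hmax, hb⟩ := h f hf0
    rcases (hq b hbs).lt_or_eq with hlt | rfl
    · rw [weightedHomogeneousComponent_eq_zero' _ _
        (fun a ha => ((hmax a ha).trans_lt hlt).ne)]
      exact zero_mem _
    · exact Ideal.subset_span ⟨f, hf, hf0, hb.symm⟩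

/-- The sum of the terms of `f` whose weight is maximal is a weighted homogeneous component. -/
theorem sum_filter_max_eq_weightedHomogeneousComponent {k Γ : Type*} [Field k] [AddCommGroup Γ]
    [LinearOrder Γ] {n : ℕ} (v : Fin n → Γ) (f : MvPolynomial (Fin n) k) (hf : f ≠ 0)
    (r : (Fin n →₀ ℕ) → (Fin n →₀ ℕ) → Prop)
    [DecidablePred fun b => ∀ a ∈ f.support, r a b]
    (hr : ∀ a b, r a b ↔ Finsupp.weight v a ≤ Finsupp.weight v b) :
    ∃ b ∈ f.support, (∀ a ∈ f.support, Finsupp.weight v a ≤ Finsupp.weight v b) ∧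
      ∑ b ∈ f.support.filter (fun b => ∀ a ∈ f.support, r a b), monomial b (coeff b f) =
        weightedHomogeneousComponent v (Finsupp.weight v b) f := by
  obtain ⟨b, hb, hmax⟩ := f.support.exists_max_image (Finsupp.weight v)
    (support_nonempty.2 hf)
  refine ⟨b, hb, hmax, ?_⟩
  rw [weightedHomogeneousComponent_apply]
  refine Finset.sum_congr (Finset.filter_congr fun c hc => ?_) fun _ _ => rfl
  simp only [hr]
  exact ⟨fun h => le_antisymm (hmax c hc) (h b hb), fun h a ha => h ▸ hmax a ha⟩

/-- `g` is the top part, for both `v` and `w`, of a homogeneous element of `I`. -/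
def HasCommonTop {k Γ : Type*} [Field k] [AddCommGroup Γ] [LinearOrder Γ] {n : ℕ}
    (v : Fin n → Γ) (w : Fin n → ℤ) (I : Ideal (MvPolynomial (Fin n) k))
    (g : MvPolynomial (Fin n) k) : Prop :=
  ∃ f ∈ I, ∃ (j : ℕ) (q : Γ) (s : ℤ), f.IsHomogeneous j ∧
    (∀ a ∈ f.support, Finsupp.weight v a ≤ q ∧ Finsupp.weight w a ≤ s ∧
      (Finsupp.weight v a = q ↔ Finsupp.weight w a = s)) ∧
    g = weightedHomogeneousComponent v q f

section CommonTop

variable {k Γ : Type*} [Field k] [AddCommGroup Γ] [LinearOrder Γ] {n : ℕ}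
  {v : Fin n → Γ} {w : Fin n → ℤ} {I : Ideal (MvPolynomial (Fin n) k)}

theorem HasCommonTop.mem_topIdeal {g : MvPolynomial (Fin n) k} (hg : HasCommonTop v w I g) :
    g ∈ topIdeal w I := by
  obtain ⟨f, hf, j, q, s, hj, hfs, rfl⟩ := hg
  refine Ideal.subset_span ⟨f, hf, j, s, hj, fun a ha => (hfs a ha).2.1, ?_⟩
  ext b
  rw [coeff_weightedHomogeneousComponent, coeff_weightedHomogeneousComponent]
  by_cases hb : b ∈ f.support
  · simp only [(hfs b hb).2.2]
  · simp [notMem_support_iff.1 hb]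

/-- `F ∈ I` lifts the part of `h` of degree `j`, `v`-weight `p` and `w`-weight at most `s`, and
its part of `w`-weight `s` lies in `J`. -/
structure IsLift (v : Fin n → Γ) (w : Fin n → ℤ) (I J : Ideal (MvPolynomial (Fin n) k))
    (j : ℕ) (p : Γ) (s : ℤ) (h F : MvPolynomial (Fin n) k) : Prop where
  mem : F ∈ I
  homogeneous : F.IsHomogeneous j
  weight_le : ∀ a, coeff a F ≠ 0 → Finsupp.weight v a ≤ p ∧ Finsupp.weight w a ≤ s
  coeff_eq : ∀ b : Fin n →₀ ℕ, Finsupp.weight 1 b = j → Finsupp.weight v b = p →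
    Finsupp.weight w b ≤ s → coeff b F = coeff b h
  component_mem : weightedHomogeneousComponent w s F ∈ J

theorem IsLift.zero {J : Ideal (MvPolynomial (Fin n) k)} {j : ℕ} {p : Γ} {s : ℤ}
    {h : MvPolynomial (Fin n) k} (hh : ∀ b : Fin n →₀ ℕ, Finsupp.weight 1 b = j →
      Finsupp.weight v b = p → Finsupp.weight w b ≤ s → coeff b h = 0) :
    IsLift v w I J j p s h 0 where
  mem := zero_mem _
  homogeneous := isHomogeneous_zero _ _ _
  weight_le := fun a ha => absurd (coeff_zero a) ha
  coeff_eq := fun b h1 h2 h3 => by rw [hh b h1 h2 h3, coeff_zero]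
  component_mem := by rw [map_zero]; exact zero_mem _

theorem IsLift.add {J : Ideal (MvPolynomial (Fin n) k)} {j : ℕ} {p : Γ} {s : ℤ}
    {h₁ h₂ F₁ F₂ : MvPolynomial (Fin n) k} (H₁ : IsLift v w I J j p s h₁ F₁)
    (H₂ : IsLift v w I J j p s h₂ F₂) : IsLift v w I J j p s (h₁ + h₂) (F₁ + F₂) where
  mem := add_mem H₁.mem H₂.mem
  homogeneous := H₁.homogeneous.add H₂.homogeneous
  weight_le := fun a ha => by
    by_cases h0 : coeff a F₁ = 0
    · exact H₂.weight_le a (by rwa [coeff_add, h0, zero_add] at ha)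
    · exact H₁.weight_le a h0
  coeff_eq := fun b h1 h2 h3 => by
    rw [coeff_add, coeff_add, H₁.coeff_eq b h1 h2 h3, H₂.coeff_eq b h1 h2 h3]
  component_mem := by rw [map_add]; exact add_mem H₁.component_mem H₂.component_mem

theorem HasCommonTop.exists_isLift_monomial_mul [IsOrderedAddMonoid Γ]
    {J : Ideal (MvPolynomial (Fin n) k)} {g : MvPolynomial (Fin n) k}
    (hg : HasCommonTop v w I g) (hgJ : g ∈ J) (j : ℕ) (p : Γ) (s : ℤ)
    (a : Fin n →₀ ℕ) (c : k) : ∃ F, IsLift v w I J j p s (monomial a c * g) F := by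
  obtain ⟨f, hf, i, q, t, hi, hfs, rfl⟩ := hg
  simp only [mem_support_iff] at hfs
  by_cases hc : Finsupp.weight 1 a + i = j ∧ Finsupp.weight v a + q = p ∧
      Finsupp.weight w a + t ≤ s
  · obtain ⟨rfl, rfl, hs⟩ := hc
    have hsupp : ∀ b, coeff b (monomial a c * f) ≠ 0 → ∃ b', b = a + b' ∧ coeff b' f ≠ 0 := by
      intro b hb
      rw [coeff_monomial_mul'] at hb
      split_ifs at hb with hab
      · exact ⟨b - a, (add_tsub_cancel_of_le hab).symm, right_ne_zero_of_mul hb⟩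
      · exact absurd rfl hb
    refine ⟨monomial a c * f, Ideal.mul_mem_left _ _ hf, ?_, ?_, ?_, ?_⟩
    · intro b hb
      obtain ⟨b', rfl, hb'⟩ := hsupp b hb
      rw [map_add, hi hb']
    · intro b hb
      obtain ⟨b', rfl, hb'⟩ := hsupp b hb
      obtain ⟨h1, h2, -⟩ := hfs b' hb'
      rw [map_add, map_add]
      exact ⟨add_le_add_right h1 _, (add_le_add_right h2 _).trans hs⟩
    · intro b _ hb _
      rw [coeff_monomial_mul', coeff_monomial_mul']
      split_ifs with hab
      · obtain ⟨b', rfl⟩ := exists_add_of_le hab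
        rw [map_add, add_right_inj] at hb
        rw [add_tsub_cancel_left, coeff_weightedHomogeneousComponent, if_pos hb]
      · rfl
    · rcases hs.lt_or_eq with hlt | rfl
      · rw [weightedHomogeneousComponent_eq_zero']
        · exact zero_mem _
        · intro b hb
          obtain ⟨b', rfl, hb'⟩ := hsupp b (mem_support_iff.1 hb)
          rw [map_add]
          exact ((add_le_add_right (hfs b' hb').2.1 _).trans_lt hlt).ne
      · convert Ideal.mul_mem_left J (monomial a c) hgJ using 1
        ext b
        rw [coeff_weightedHomogeneousComponent, coeff_monomial_mul', coeff_monomial_mul']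
        by_cases hab : a ≤ b
        · obtain ⟨b', rfl⟩ := exists_add_of_le hab
          simp only [map_add, add_right_inj, if_pos hab, add_tsub_cancel_left,
            coeff_weightedHomogeneousComponent]
          by_cases h0 : coeff b' f = 0
          · simp [h0]
          · simp only [(hfs b' h0).2.2]
            split_ifs <;> simp
        · simp [hab]
  · refine ⟨0, IsLift.zero fun b h1 h2 h3 => ?_⟩
    rw [coeff_monomial_mul']
    split_ifs with hab
    · obtain ⟨b', rfl⟩ := exists_add_of_le hab
      rw [add_tsub_cancel_left, coeff_weightedHomogeneousComponent]
      split_ifs with hq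
      · by_cases h0 : coeff b' f = 0
        · rw [h0, mul_zero]
        · rw [map_add] at h1 h2 h3
          rw [hi h0] at h1
          rw [hq] at h2
          rw [(hfs b' h0).2.2.1 hq] at h3
          exact absurd ⟨h1, h2, h3⟩ hc
      · rw [mul_zero]
    · rfl

theorem exists_isLift_of_mem_span [IsOrderedAddMonoid Γ] {T : Set (MvPolynomial (Fin n) k)}
    (hT : ∀ g ∈ T, g ≠ 0 → HasCommonTop v w I g) (j : ℕ) (p : Γ) (s : ℤ)
    {h : MvPolynomial (Fin n) k} (hh : h ∈ Ideal.span T) :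
    ∃ F, IsLift v w I (Ideal.span T) j p s h F := by
  suffices H : ∀ r, ∃ F, IsLift v w I (Ideal.span T) j p s (r * h) F by simpa using H 1
  induction hh using Submodule.span_induction with
  | mem g hg =>
    by_cases hg0 : g = 0
    · exact fun r => ⟨0, IsLift.zero fun b _ _ _ => by simp [hg0]⟩
    intro r
    induction r using MvPolynomial.induction_on' with
    | monomial a c =>
      exact (hT g hg hg0).exists_isLift_monomial_mul (Ideal.subset_span hg) j p s a c
    | add r₁ r₂ ih₁ ih₂ =>
      obtain ⟨F₁, H₁⟩ := ih₁
      obtain ⟨F₂, H₂⟩ := ih₂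
      exact ⟨F₁ + F₂, by rw [add_mul]; exact H₁.add H₂⟩
  | zero => exact fun r => ⟨0, IsLift.zero fun b _ _ _ => by simp⟩
  | add x y _ _ hx hy =>
    intro r
    obtain ⟨F₁, H₁⟩ := hx r
    obtain ⟨F₂, H₂⟩ := hy r
    exact ⟨F₁ + F₂, by rw [mul_add]; exact H₁.add H₂⟩
  | smul c x _ hx =>
    intro r
    rw [smul_eq_mul, ← mul_assoc]
    exact hx _

/-- If `topIdeal v I` is spanned by top parts common to `v` and `w`, it contains all top parts
with respect to `w`. -/
theorem topIdeal_le_of_hasCommonTop [IsOrderedAddMonoid Γ] {T : Set (MvPolynomial (Fin n) k)}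
    (hT : ∀ g ∈ T, g ≠ 0 → HasCommonTop v w I g) (hspan : Ideal.span T = topIdeal v I) :
    topIdeal w I ≤ topIdeal v I := by
  conv_lhs => rw [topIdeal]
  rw [Ideal.span_le]
  rintro g ⟨f, hf, j, s, hj, hs, rfl⟩
  let U : Finset Γ := (Finsupp.finite_of_degree_eq (σ := Fin n) j).toFinset.image
    (Finsupp.weight v)
  have hU : ∀ f : MvPolynomial (Fin n) k, f.IsHomogeneous j →
      ∀ a ∈ f.support, Finsupp.weight v a ∈ U := fun f hf a ha => by
    refine Finset.mem_image_of_mem _ ((Set.Finite.mem_toFinset _).2 ?_)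
    rw [Set.mem_ofPred_eq, Finsupp.degree_eq_weight_one]
    exact hf (mem_support_iff.1 ha)
  induction hN : (U.filter (fun u => ∃ a ∈ f.support, u ≤ Finsupp.weight v a)).card
    using Nat.strong_induction_on generalizing f with
  | _ N ih =>
  by_cases hf0 : f = 0
  · rw [hf0, map_zero]
    exact zero_mem _
  obtain ⟨b, hb, hmax⟩ := f.support.exists_max_image (Finsupp.weight v) (support_nonempty.2 hf0)
  have hmem : weightedHomogeneousComponent v (Finsupp.weight v b) f ∈ Ideal.span T :=
    hspan ▸ Ideal.subset_span ⟨f, hf, j, _, hj, hmax, rfl⟩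
  obtain ⟨F, hF⟩ := exists_isLift_of_mem_span hT j (Finsupp.weight v b) s hmem
  have hle : ∀ a ∈ (f - F).support, Finsupp.weight v a ≤ Finsupp.weight v b ∧
      Finsupp.weight w a ≤ s := fun a ha => by
    by_cases h0 : coeff a f = 0
    · refine hF.weight_le a fun h1 => ?_
      rw [mem_support_iff, coeff_sub, h0, h1, sub_zero] at ha
      exact ha rfl
    · exact ⟨hmax a (mem_support_iff.2 h0), hs a (mem_support_iff.2 h0)⟩
  have hhom : (f - F).IsHomogeneous j := hj.sub hF.homogeneous
  have hlt : ∀ a ∈ (f - F).support, Finsupp.weight v a < Finsupp.weight v b := fun a ha => by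
    refine (hle a ha).1.lt_of_ne fun heq => mem_support_iff.1 ha ?_
    rw [coeff_sub, hF.coeff_eq a (hhom (mem_support_iff.1 ha)) heq (hle a ha).2,
      coeff_weightedHomogeneousComponent, if_pos heq, sub_self]
  have hrec := ih _ (by
    rw [← hN]
    refine Finset.card_lt_card (Finset.ssubset_iff_of_subset ?_ |>.2 ?_)
    · intro u hu
      obtain ⟨huU, a, ha, hua⟩ := Finset.mem_filter.1 hu
      exact Finset.mem_filter.2 ⟨huU, b, hb, hua.trans (hlt a ha).le⟩
    · refine ⟨Finsupp.weight v b, Finset.mem_filter.2 ⟨hU f hj b hb, b, hb, le_rfl⟩, fun hu => ?_⟩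
      obtain ⟨-, a, ha, hua⟩ := Finset.mem_filter.1 hu
      exact absurd hua (hlt a ha).not_ge)
    (f - F) (sub_mem hf hF.mem) hhom (fun a ha => (hle a ha).2) rfl
  have hsum := add_mem hrec (hspan ▸ hF.component_mem)
  rwa [← map_add, sub_add_cancel] at hsum

end CommonTop

/-- The top parts of a homogeneous ideal with respect to a weight in an ordered group are also
the top parts with respect to some integral weight vector. -/
theorem exists_int_weight_topIdeal_eq {k Γ : Type*} [Field k] [AddCommGroup Γ] [LinearOrder Γ]
    [IsOrderedAddMonoid Γ] {n : ℕ} (v : Fin n → Γ) (I : Ideal (MvPolynomial (Fin n) k)) :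
    ∃ w : Fin n → ℤ, topIdeal w I = topIdeal v I := by
  obtain ⟨T, hTsub, hT⟩ := (Submodule.fg_span_iff_fg_span_finset_subset _).1
    (IsNoetherian.noetherian (topIdeal v I))
  have hspan : Ideal.span (T : Set (MvPolynomial (Fin n) k)) = topIdeal v I := hT.symm
  have hgen : ∀ g ∈ T, ∃ f ∈ I, ∃ (j : ℕ) (q : Γ), f.IsHomogeneous j ∧
      (∀ a ∈ f.support, Finsupp.weight v a ≤ q) ∧ g = weightedHomogeneousComponent v q f :=
    fun g hg => hTsub hg
  choose! f hf j q hj hq hg using hgen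
  obtain ⟨w, hw⟩ := exists_int_weight_strictMonoOn v (T.biUnion fun g => (f g).support)
  have hcommon : ∀ g ∈ (T : Set (MvPolynomial (Fin n) k)), g ≠ 0 → HasCommonTop v w I g := by
    intro g hgT hg0
    obtain ⟨b, hb, hbq⟩ : ∃ b ∈ (f g).support, Finsupp.weight v b = q g := by
      by_contra! hne
      exact hg0 ((hg g hgT).trans (weightedHomogeneousComponent_eq_zero' _ _ hne))
    refine ⟨f g, hf g hgT, j g, q g, Finsupp.weight w b, hj g hgT, fun a ha => ?_, hg g hgT⟩
    obtain ⟨hlt, heq⟩ := hw a (Finset.mem_biUnion.2 ⟨g, hgT, ha⟩) b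
      (Finset.mem_biUnion.2 ⟨g, hgT, hb⟩)
    rw [hbq] at hlt heq
    rcases (hq g hgT a ha).lt_or_eq with h | h
    · exact ⟨h.le, (hlt h).le, fun h' => absurd h' h.ne, fun h' => absurd h' (hlt h).ne⟩
    · exact ⟨h.le, (heq h).le, fun _ => heq h, fun _ => h⟩
  refine ⟨w, le_antisymm (topIdeal_le_of_hasCommonTop hcommon hspan) ?_⟩
  rw [← hspan, Ideal.span_le]
  intro g hgT
  by_cases hg0 : g = 0
  · rw [hg0]
    exact zero_mem _
  · exact (hcommon g hgT hg0).mem_topIdeal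

/-- A copy of `ℤ^d` carrying no order. -/
def IntLattice (d : ℕ) : Type := Fin d → ℤ

instance (d : ℕ) : AddCommGroup (IntLattice d) := inferInstanceAs (AddCommGroup (Fin d → ℤ))

/-- Evaluation of a coordinate of a lattice vector. -/
def IntLattice.coord {d : ℕ} (t : Fin d) : IntLattice d →+ ℤ :=
  Pi.evalAddMonoidHom (fun _ => ℤ) t

theorem weight_eq_wdotZ {n : ℕ} (w : Fin n → ℤ) (a : Fin n →₀ ℕ) :
    Finsupp.weight w a = wdotZ w a := by
  rw [Finsupp.weight_apply, Finsupp.sum_fintype _ _ (by simp)]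
  exact Finset.sum_congr rfl fun i _ => by simp [mul_comm]

/-- Weights given by the columns of `M` are the products `M·a`. -/
theorem weight_eq_MdotZ {d n : ℕ} (M : Fin d → Fin n → ℤ) (v : Fin n → IntLattice d)
    (hv : ∀ i t, IntLattice.coord t (v i) = M t i) (a : Fin n →₀ ℕ) :
    Finsupp.weight v a = MdotZ M a := by
  funext t
  have h : IntLattice.coord t (Finsupp.weight v a) = Finsupp.weight (M t) a := by
    simp [Finsupp.weight_apply, Finsupp.sum, hv]
  exact h.trans (weight_eq_wdotZ (M t) a)

theorem weight_vector_representing_weighting_matrix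
    {k : Type*} [Field k] {n d : ℕ}
    (I : Ideal (MvPolynomial (Fin n) k))
    -- `I` is homogeneous:
    (hIhom : ∀ f ∈ I, ∀ j : ℕ, MvPolynomial.homogeneousComponent j f ∈ I)
    -- a translation-invariant total order on `ℤ^d`:
    (le : (Fin d → ℤ) → (Fin d → ℤ) → Prop)
    (hlin : IsLinearOrder (Fin d → ℤ) le)
    (hcompat : ∀ u v w : Fin d → ℤ, le u v → le (u + w) (v + w))
    -- a weighting matrix:
    (M : Fin d → Fin n → ℤ) :
    -- there is a weight vector `w` with `init_w(I) = init_M(I)`: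
    ∃ w : Fin n → ℤ, initIdealZ w I = initIdealMZ le M I := by
  let _ : LinearOrder (IntLattice d) :=
    { le := le
      le_refl := hlin.refl
      le_trans := hlin.trans
      le_antisymm := hlin.antisymm
      le_total := hlin.total
      toDecidableLE := Classical.decRel _ }
  have _ : IsOrderedAddMonoid (IntLattice d) :=
    { add_le_add_left := fun u v huv w => hcompat u v w huv }
  let v : Fin n → IntLattice d := fun i t => M t i
  have hv : ∀ a, (Finsupp.weight v a : IntLattice d) = MdotZ M a :=
    weight_eq_MdotZ M v fun _ _ => rfl
  obtain ⟨w, hw⟩ := exists_int_weight_topIdeal_eq v I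
  refine ⟨w, (span_initForm_eq_topIdeal w I hIhom (initFormZ w) fun f hf => ?_).trans
    (hw.trans (span_initForm_eq_topIdeal v I hIhom (initFormMZ le M) fun f hf => ?_).symm)⟩
  · exact sum_filter_max_eq_weightedHomogeneousComponent w f hf
      (fun a b => wdotZ w a ≤ wdotZ w b) fun a b => by rw [weight_eq_wdotZ, weight_eq_wdotZ]
  · exact sum_filter_max_eq_weightedHomogeneousComponent v f hf
      (fun a b => le (MdotZ M a) (MdotZ M b)) fun a b => by rw [hv, hv]; exact Iff.rfl
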